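/- Let 1 ≤ p < ∞ and α = 2 - 1/p. Define f on the unit disc by f(r e^{iθ}) = θ^α (1 - (1-θ) r e^{-iθ})^{-2} if 0 < θ < 1/2 and 0 < r < 1 - 2θ, and f = 0 otherwise. Then f ∈ L^∞(𝕋, L^p[0,1]) (i.e. sup_θ ∫₀¹ |f(re^{iθ})|^p dr < ∞), but its Bergman projection P(f)(z) = ∫_𝔻 (1 - z w̄)^{-2} f(w) dA(w)/π satisfies |P(f)(a)| ≳ (1-a)^{-1/p} for all a ∈ (3/4, 1); consequently P(f) ∉ RM(p,∞). -/

import Mathlib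

open MeasureTheory Complex Real ENNReal

/-- The function `f(re^{iθ}) = θ^{2-1/p} (1-(1-θ) r e^{-iθ})^{-2}` for `0 < θ < 1/2`,
`0 < r < 1-2θ`, and `0` otherwise. -/
noncomputable def badF (p : ℝ) (w : ℂ) : ℂ :=
  if 0 < w.arg ∧ w.arg < 1 / 2 ∧ ‖w‖ < 1 - 2 * w.arg then
    ((w.arg ^ (2 - 1 / p) : ℝ) : ℂ) /
      (1 - ((1 - w.arg : ℝ) : ℂ) * ((‖w‖ : ℝ) : ℂ) *
          Complex.exp (-(w.arg : ℂ) * Complex.I)) ^ 2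
  else 0

/-- The Bergman projection `P(g)(z) = (1/π) ∫_𝔻 g(w) (1 - z w̄)^{-2} dA(w)`. -/
noncomputable def bergmanProj (g : ℂ → ℂ) (z : ℂ) : ℂ :=
  (Real.pi : ℂ)⁻¹ *
    ∫ w in Metric.ball (0 : ℂ) 1, g w / (1 - z * (starRingEnd ℂ) w) ^ 2


noncomputable def KK (t ρ : ℝ) : ℂ := 1 - (ρ : ℂ) * Complex.exp (-(t : ℂ) * Complex.I)

lemma exp_neg_eq (t : ℝ) : Complex.exp (-(t : ℂ) * Complex.I) =
    (Real.cos t : ℂ) - (Real.sin t : ℂ) * Complex.I := by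
  rw [Complex.exp_mul_I, Complex.cos_neg, Complex.sin_neg, Complex.ofReal_cos, Complex.ofReal_sin]
  ring

lemma KK_re (t ρ : ℝ) : (KK t ρ).re = 1 - ρ * Real.cos t := by
  rw [KK, exp_neg_eq]
  simp [-Complex.ofReal_cos, -Complex.ofReal_sin]

lemma KK_im (t ρ : ℝ) : (KK t ρ).im = ρ * Real.sin t := by
  rw [KK, exp_neg_eq]
  simp [-Complex.ofReal_cos, -Complex.ofReal_sin]

lemma KK_im_nonneg {t ρ : ℝ} (ht : 0 < t) (ht2 : t < 1 / 2) (hρ : 0 ≤ ρ) : 0 ≤ (KK t ρ).im := by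
  rw [KK_im]
  exact mul_nonneg hρ (Real.sin_nonneg_of_nonneg_of_le_pi ht.le (by linarith [Real.pi_gt_three]))

lemma KK_im_le {t ρ : ℝ} (ht : 0 < t) (hρ : 0 ≤ ρ) : (KK t ρ).im ≤ ρ * t := by
  rw [KK_im]
  exact mul_le_mul_of_nonneg_left (Real.sin_le ht.le) hρ

lemma KK_re_ge {t ρ : ℝ} (hρ : 0 ≤ ρ) : 1 - ρ ≤ (KK t ρ).re := by
  rw [KK_re]
  nlinarith [Real.cos_le_one t]

lemma KK_norm_ge {t ρ : ℝ} (hρ : 0 ≤ ρ) : 1 - ρ ≤ ‖KK t ρ‖ :=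
  (KK_re_ge hρ).trans (Complex.re_le_norm _)

lemma KK_half {t ρ : ℝ} (ht : 0 < t) (hρ : 0 ≤ ρ) (h : ρ ≤ 1 - 2 * t) :
    2 * (KK t ρ).im ≤ (KK t ρ).re := by
  have h1 := KK_im_le ht hρ
  have h2 := KK_re_ge (t := t) hρ
  nlinarith

lemma KK_third {t ρ : ℝ} (ht : 0 < t) (ht2 : t < 1 / 2) (hρ : 0 ≤ ρ) (h : ρ ≤ (1 - t) * (1 - 2 * t)) :
    3 * (KK t ρ).im ≤ (KK t ρ).re := by
  have h1 := KK_im_le ht hρ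
  have h2 := KK_re_ge (t := t) hρ
  have h3 : ρ * (1 + 3 * t) ≤ (1 - t) * (1 - 2 * t) * (1 + 3 * t) :=
    mul_le_mul_of_nonneg_right h (by linarith)
  nlinarith [mul_nonneg (sq_nonneg t) (by linarith : (0:ℝ) ≤ 7 - 6 * t)]

lemma invAB_re (A B : ℂ) : ((A ^ 2 * B ^ 2)⁻¹).re =
    ((A.re * B.re - A.im * B.im) ^ 2 - (A.re * B.im + A.im * B.re) ^ 2) /
      ((A.re ^ 2 + A.im ^ 2) * (B.re ^ 2 + B.im ^ 2)) ^ 2 := by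
  rw [Complex.inv_re]
  congr 1
  · simp [pow_two]; ring
  · rw [map_mul, map_pow, map_pow, Complex.normSq_apply, Complex.normSq_apply]; ring

lemma inv_re_nonneg {A B : ℂ} (hA : 0 ≤ A.im) (hB : 0 ≤ B.im) (h3 : 3 * A.im ≤ A.re)
    (h2 : 2 * B.im ≤ B.re) : 0 ≤ ((A ^ 2 * B ^ 2)⁻¹).re := by
  rw [invAB_re]
  apply div_nonneg _ (sq_nonneg _)
  rw [sub_nonneg]
  apply pow_le_pow_left₀
  · have : 0 ≤ A.re := by linarith
    have : 0 ≤ B.re := by linarith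
    positivity
  · nlinarith [mul_nonneg (sub_nonneg.2 h3) (sub_nonneg.2 h2), mul_nonneg hA (sub_nonneg.2 h2), mul_nonneg hB (sub_nonneg.2 h3)]

lemma inv_re_lower {A B : ℂ} {m : ℝ} (hA : 0 ≤ A.im) (hB : 0 ≤ B.im) (h3 : 3 * A.im ≤ A.re)
    (h2 : 3 * B.im ≤ B.re) (hA0 : 0 < A.re) (hB0 : 0 < B.re) (hAm : A.re ≤ m) (hBm : B.re ≤ m) :
    1 / (5 * m ^ 4) ≤ ((A ^ 2 * B ^ 2)⁻¹).re := by
  rw [invAB_re]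
  have hX : 0 < A.re * B.re := by positivity
  have e1 : A.im * B.im ≤ A.re * B.re / 9 := by nlinarith
  have e2 : A.re * B.im + A.im * B.re ≤ 2 / 3 * (A.re * B.re) := by nlinarith
  have e3 : 0 ≤ A.re * B.im + A.im * B.re := by positivity
  have n1 : (A.re * B.im + A.im * B.re) ^ 2 ≤ (2 / 3 * (A.re * B.re)) ^ 2 :=
    pow_le_pow_left₀ e3 e2 2
  have n2 : (8 / 9 * (A.re * B.re)) ^ 2 ≤ (A.re * B.re - A.im * B.im) ^ 2 :=
    pow_le_pow_left₀ (by positivity) (by linarith) 2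
  have d1 : A.re ^ 2 + A.im ^ 2 ≤ 10 / 9 * A.re ^ 2 := by nlinarith
  have d2 : B.re ^ 2 + B.im ^ 2 ≤ 10 / 9 * B.re ^ 2 := by nlinarith
  have d3 : ((A.re ^ 2 + A.im ^ 2) * (B.re ^ 2 + B.im ^ 2)) ^ 2 ≤
      ((10 / 9 * A.re ^ 2) * (10 / 9 * B.re ^ 2)) ^ 2 := by gcongr
  have hm : A.re * B.re ≤ m * m := by gcongr; linarith
  have hm2 : (A.re * B.re) ^ 2 ≤ (m * m) ^ 2 := by gcongr
  have hm0 : 0 < m := by linarith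
  calc 1 / (5 * m ^ 4) ≤ 1 / (5 * (A.re * B.re) ^ 2) := by
        apply one_div_le_one_div_of_le (by positivity)
        nlinarith
    _ ≤ (28 / 81 * (A.re * B.re) ^ 2) / ((10 / 9 * A.re ^ 2) * (10 / 9 * B.re ^ 2)) ^ 2 := by
        rw [div_le_div_iff₀ (by positivity) (by positivity)]
        have : 0 < (A.re * B.re) ^ 4 := by positivity
        nlinarith
    _ ≤ _ := by
        apply div_le_div₀ _ _ _ d3
        · have : (0:ℝ) ≤ (8 / 9 * (A.re * B.re)) ^ 2 - (2 / 3 * (A.re * B.re)) ^ 2 := by nlinarith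
          nlinarith
        · nlinarith
        · positivity

lemma badF_polar (p r t : ℝ) (hr : 0 < r) (ht : t ∈ Set.Ioc (-Real.pi) Real.pi) :
    badF p ((r : ℂ) * Complex.exp ((t : ℂ) * Complex.I)) =
      if 0 < t ∧ t < 1 / 2 ∧ r < 1 - 2 * t then
        ((t ^ (2 - 1 / p) : ℝ) : ℂ) / (KK t ((1 - t) * r)) ^ 2 else 0 := by
  have harg : ((r : ℂ) * Complex.exp ((t : ℂ) * Complex.I)).arg = t := by
    rw [Complex.exp_mul_I]
    exact Complex.arg_mul_cos_add_sin_mul_I hr ht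
  have hn : ‖(r : ℂ) * Complex.exp ((t : ℂ) * Complex.I)‖ = r := by
    rw [norm_mul, Complex.norm_exp_ofReal_mul_I, Complex.norm_real, Real.norm_of_nonneg hr.le, mul_one]
  unfold badF KK
  rw [harg, hn]
  push_cast
  rfl

noncomputable def GG (p a : ℝ) (q : ℝ × ℝ) : ℂ :=
  if 0 < q.2 ∧ q.2 < 1 / 2 ∧ 0 < q.1 ∧ q.1 < 1 - 2 * q.2 then
    ((q.1 * q.2 ^ (2 - 1 / p) : ℝ) : ℂ) *
      ((KK q.2 ((1 - q.2) * q.1)) ^ 2 * (KK q.2 (a * q.1)) ^ 2)⁻¹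
  else 0

lemma KK_conj (a r t : ℝ) :
    1 - (a : ℂ) * (starRingEnd ℂ) ((r : ℂ) * Complex.exp ((t : ℂ) * Complex.I)) = KK t (a * r) := by
  unfold KK
  rw [map_mul, ← Complex.exp_conj]
  simp
  ring

lemma proj_eq (p a : ℝ) :
    (∫ w in Metric.ball (0 : ℂ) 1, badF p w / (1 - (a : ℂ) * (starRingEnd ℂ) w) ^ 2) =
      ∫ q, GG p a q := by
  rw [← integral_indicator Metric.isOpen_ball.measurableSet,
    ← Complex.integral_comp_polarCoord_symm, ← integral_indicator polarCoord.open_target.measurableSet]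
  congr 1
  funext q
  obtain ⟨r, t⟩ := q
  by_cases hq : (r, t) ∈ polarCoord.target
  · rw [Set.indicator_of_mem hq]
    rw [polarCoord_target, Set.mem_prod] at hq
    obtain ⟨hr, ht⟩ := hq
    simp only [Set.mem_Ioi] at hr
    have e : (Complex.polarCoord.symm (r, t)) = (r : ℂ) * Complex.exp ((t : ℂ) * Complex.I) := by
      rw [Complex.polarCoord_symm_apply, Complex.exp_mul_I, Complex.ofReal_cos, Complex.ofReal_sin]
    have hn : ‖(r : ℂ) * Complex.exp ((t : ℂ) * Complex.I)‖ = r := by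
      rw [norm_mul, Complex.norm_exp_ofReal_mul_I, Complex.norm_real, Real.norm_of_nonneg hr.le, mul_one]
    rw [e]
    unfold GG
    dsimp only
    by_cases hc : 0 < t ∧ t < 1 / 2 ∧ r < 1 - 2 * t
    · rw [Set.indicator_of_mem (by rw [mem_ball_zero_iff, hn]; linarith),
        badF_polar p r t hr ⟨ht.1, ht.2.le⟩, KK_conj, if_pos hc, if_pos ⟨hc.1, hc.2.1, hr, hc.2.2⟩]
      rw [Complex.real_smul]
      push_cast
      rw [mul_inv, div_eq_mul_inv, div_eq_mul_inv]
      ring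
    · rw [if_neg (fun h => hc ⟨h.1, h.2.1, h.2.2.2⟩)]
      have hz : badF p ((r : ℂ) * Complex.exp ((t : ℂ) * Complex.I)) = 0 := by
        rw [badF_polar p r t hr ⟨ht.1, ht.2.le⟩, if_neg hc]
      by_cases hb : (r : ℂ) * Complex.exp ((t : ℂ) * Complex.I) ∈ Metric.ball (0 : ℂ) 1
      · rw [Set.indicator_of_mem hb, hz]
        simp
      · rw [Set.indicator_of_notMem hb, smul_zero]
  · rw [Set.indicator_of_notMem hq]
    unfold GG
    rw [if_neg]
    rintro ⟨h1, h2, h3, h4⟩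
    apply hq
    rw [polarCoord_target, Set.mem_prod]
    exact ⟨h3, by simp only; linarith [Real.pi_gt_three], by simp only at *; linarith [Real.pi_gt_three]⟩

lemma GG_measurable (p a : ℝ) : Measurable (GG p a) := by
  unfold GG
  apply Measurable.ite
  · simp only [measurableSet_setOfPred]
    apply Measurable.and (measurableSet_setOfPred.1 (measurableSet_lt (by fun_prop) (by fun_prop)))
    apply Measurable.and (measurableSet_setOfPred.1 (measurableSet_lt (by fun_prop) (by fun_prop)))
    exact Measurable.and (measurableSet_setOfPred.1 (measurableSet_lt (by fun_prop) (by fun_prop)))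
      (measurableSet_setOfPred.1 (measurableSet_lt (by fun_prop) (by fun_prop)))
  · unfold KK
    fun_prop
  · fun_prop

lemma D_integrable : IntegrableOn (fun q : ℝ × ℝ => (1 - q.1) ^ (-(1/2) : ℝ) * q.2 ^ (-(1/2) : ℝ))
    (Set.Ioo (0:ℝ) 1 ×ˢ Set.Ioo (0:ℝ) 1) := by
  have h1 : IntegrableOn (fun x : ℝ => x ^ (-(1/2) : ℝ)) (Set.Ioo (0:ℝ) 1) := by
    have := intervalIntegral.intervalIntegrable_rpow' (a := 0) (b := 1) (r := (-(1/2) : ℝ)) (by norm_num)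
    rw [intervalIntegrable_iff_integrableOn_Ioo_of_le zero_le_one] at this
    exact this
  have h2 : IntegrableOn (fun x : ℝ => (1 - x) ^ (-(1/2) : ℝ)) (Set.Ioo (0:ℝ) 1) := by
    have := (intervalIntegral.intervalIntegrable_rpow' (a := 0) (b := 1) (r := (-(1/2) : ℝ)) (by norm_num)).comp_sub_left 1
    simp only [sub_zero, sub_self] at this
    have := this.symm
    rw [intervalIntegrable_iff_integrableOn_Ioo_of_le zero_le_one] at this
    exact this
  unfold IntegrableOn
  rw [Measure.volume_eq_prod, ← Measure.prod_restrict]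
  exact Integrable.mul_prod h2 h1

lemma rpow_alpha_le {p t : ℝ} (hp : 1 ≤ p) (ht : 0 < t) (ht2 : t < 1 / 2) : t ^ (2 - 1 / p) ≤ t := by
  have : 1 / p ≤ 1 := by rw [div_le_one (by linarith)]; exact hp
  calc t ^ (2 - 1 / p) ≤ t ^ (1 : ℝ) :=
        Real.rpow_le_rpow_of_exponent_ge ht (by linarith) (by linarith)
    _ = t := Real.rpow_one t

lemma GG_integrable (p a : ℝ) (hp : 1 ≤ p) (ha0 : 0 < a) (ha : a < 1) : Integrable (GG p a) := by
  have hD := ((integrable_indicator_iff (measurableSet_Ioo.prod measurableSet_Ioo)).2 D_integrable).const_mul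
    (((1 - a) ^ 2)⁻¹)
  refine hD.mono' (GG_measurable p a).aestronglyMeasurable (Filter.Eventually.of_forall ?_)
  rintro ⟨r, t⟩
  unfold GG
  dsimp only
  have h1a : 0 < 1 - a := by linarith
  split_ifs with hc
  · obtain ⟨h1, h2, h3, h4⟩ := hc
    have hr1 : 0 < 1 - r := by linarith
    rw [Set.indicator_of_mem (show (r, t) ∈ Set.Ioo (0:ℝ) 1 ×ˢ Set.Ioo (0:ℝ) 1 from
      ⟨⟨h3, by dsimp only; linarith⟩, ⟨h1, by dsimp only; linarith⟩⟩)]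
    have hA : 1 - r ≤ ‖KK t ((1 - t) * r)‖ :=
      le_trans (by nlinarith) (KK_norm_ge (by apply mul_nonneg <;> linarith))
    have hB : 1 - a ≤ ‖KK t (a * r)‖ :=
      le_trans (by nlinarith) (KK_norm_ge (by positivity))
    rw [norm_mul, Complex.norm_real, norm_inv, norm_mul (KK _ _ ^ 2), norm_pow, norm_pow,
      Real.norm_of_nonneg (by positivity), mul_inv]
    have hα := rpow_alpha_le hp h1 h2
    have e1 : (‖KK t ((1 - t) * r)‖ ^ 2)⁻¹ ≤ ((1 - r) ^ 2)⁻¹ := by gcongr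
    have e2 : (‖KK t (a * r)‖ ^ 2)⁻¹ ≤ ((1 - a) ^ 2)⁻¹ := by gcongr
    have e3 : r * t ^ (2 - 1 / p) ≤ t := by
      have : 0 ≤ t ^ (2 - 1 / p) := by positivity
      nlinarith
    have e4 : t * ((1 - r) ^ 2)⁻¹ ≤ (1 - r) ^ (-(1/2) : ℝ) * t ^ (-(1/2) : ℝ) := by
      have k : t ^ (3/2 : ℝ) ≤ (1 - r) ^ (3/2 : ℝ) :=
        Real.rpow_le_rpow h1.le (by linarith) (by norm_num)
      have kt : t = t ^ (3/2 : ℝ) * t ^ (-(1/2) : ℝ) := by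
        rw [← Real.rpow_add h1]; norm_num
      have kr : (1 - r) ^ (3/2 : ℝ) * ((1 - r) ^ 2)⁻¹ = (1 - r) ^ (-(1/2) : ℝ) := by
        rw [← Real.rpow_natCast, ← Real.rpow_neg hr1.le, ← Real.rpow_add hr1]; norm_num
      calc t * ((1 - r) ^ 2)⁻¹ = t ^ (3/2 : ℝ) * t ^ (-(1/2) : ℝ) * ((1 - r) ^ 2)⁻¹ := by rw [← kt]
        _ ≤ (1 - r) ^ (3/2 : ℝ) * t ^ (-(1/2) : ℝ) * ((1 - r) ^ 2)⁻¹ := by gcongr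
        _ = _ := by rw [← kr]; ring
    calc r * t ^ (2 - 1 / p) * ((‖KK t ((1 - t) * r)‖ ^ 2)⁻¹ * (‖KK t (a * r)‖ ^ 2)⁻¹)
        ≤ t * (((1 - r) ^ 2)⁻¹ * ((1 - a) ^ 2)⁻¹) := by gcongr
      _ = ((1 - a) ^ 2)⁻¹ * (t * ((1 - r) ^ 2)⁻¹) := by ring
      _ ≤ _ := by gcongr
  · rw [norm_zero]
    apply mul_nonneg (by positivity)
    apply Set.indicator_nonneg
    rintro ⟨x, y⟩ ⟨⟨hx1, hx2⟩, hy1, hy2⟩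
    dsimp only at *
    have : 0 < 1 - x := by linarith
    positivity

lemma GG_re_nonneg (p a : ℝ) (ha0 : 0 < a) (ha : a < 1) (q : ℝ × ℝ) : 0 ≤ (GG p a q).re := by
  obtain ⟨r, t⟩ := q
  unfold GG
  dsimp only
  split_ifs with hc
  · obtain ⟨h1, h2, h3, h4⟩ := hc
    rw [Complex.re_ofReal_mul]
    have hA0 : 0 ≤ (1 - t) * r := by apply mul_nonneg <;> linarith
    have hB0 : 0 ≤ a * r := by positivity
    apply mul_nonneg (by positivity)
    apply inv_re_nonneg (KK_im_nonneg h1 h2 hA0) (KK_im_nonneg h1 h2 hB0)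
    · exact KK_third h1 h2 hA0 (by gcongr; linarith)
    · exact KK_half h1 hB0 (by nlinarith)
  · simp

lemma GG_re_lower (p a r t : ℝ) (hp : 1 ≤ p) (ha : 3 / 4 < a) (ha1 : a < 1)
    (hr : r ∈ Set.Ioo (1 - 3 * (1 - a)) (1 - 2 * (1 - a))) (ht : t ∈ Set.Ioo ((1 - a) / 2) (1 - a)) :
    1 / 80000 * ((1 - a) ^ (-(1 / p)) * ((1 - a) ^ 2)⁻¹) ≤ (GG p a (r, t)).re := by
  obtain ⟨hr1, hr2⟩ := hr
  obtain ⟨ht1, ht2⟩ := ht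
  unfold GG
  dsimp only
  set h := 1 - a with hh
  have hpos : 0 < h := by linarith
  have h1 : 0 < t := by linarith
  have h2 : t < 1 / 2 := by linarith
  have h3 : 1 / 4 < r := by linarith
  rw [if_pos ⟨h1, h2, by linarith, by linarith⟩, Complex.re_ofReal_mul]
  have hA0 : 0 ≤ (1 - t) * r := by apply mul_nonneg <;> linarith
  have hB0 : 0 ≤ a * r := by apply mul_nonneg <;> linarith
  have hcos := Real.one_sub_sq_div_two_le_cos (x := t)
  have hAr : (KK t ((1 - t) * r)).re ≤ 5 * h := by
    rw [KK_re]
    have : (1 - t) * r * (1 - t ^ 2 / 2) ≤ (1 - t) * r * Real.cos t := by gcongr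
    have : (1 - t) * r ≤ 1 := by nlinarith
    nlinarith
  have hBr : (KK t (a * r)).re ≤ 5 * h := by
    rw [KK_re]
    have : a * r * (1 - t ^ 2 / 2) ≤ a * r * Real.cos t := by gcongr
    have : a * r ≤ 1 := by nlinarith
    nlinarith
  have hA1 : (1 - t) * r ≤ (1 - t) * (1 - 2 * t) := by gcongr <;> linarith
  have hB1 : a * r ≤ (1 - t) * (1 - 2 * t) := by gcongr <;> linarith
  have lt1 : (1 - t) * (1 - 2 * t) < 1 := by nlinarith
  have key := inv_re_lower (m := 5 * h) (KK_im_nonneg h1 h2 hA0) (KK_im_nonneg h1 h2 hB0)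
    (KK_third h1 h2 hA0 hA1) (KK_third h1 h2 hB0 hB1)
    (lt_of_lt_of_le (by linarith) (KK_re_ge (t := t) hA0))
    (lt_of_lt_of_le (by linarith) (KK_re_ge (t := t) hB0)) hAr hBr
  have hp1 : 1 / p ≤ 1 := by rw [div_le_one (by linarith)]; exact hp
  have hp0 : 0 < 1 / p := by positivity
  have hpow : (1 / 4) * (h ^ (-(1 / p)) * h ^ 2) ≤ t ^ (2 - 1 / p) := by
    calc (1 / 4) * (h ^ (-(1 / p)) * h ^ 2) = (1 / 4) * h ^ (2 - 1 / p) := by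
          rw [← Real.rpow_natCast, ← Real.rpow_add hpos]; congr 2; push_cast; ring
      _ ≤ (1 / 2) ^ (2 - 1 / p) * h ^ (2 - 1 / p) := by
          gcongr
          calc (1 / 4 : ℝ) = (1 / 2) ^ (2 : ℝ) := by norm_num
            _ ≤ _ := Real.rpow_le_rpow_of_exponent_ge (by norm_num) (by norm_num) (by linarith)
      _ = (1 / 2 * h) ^ (2 - 1 / p) := by rw [Real.mul_rpow (by norm_num) hpos.le]
      _ ≤ _ := Real.rpow_le_rpow (by linarith) (by linarith) (by linarith)
  calc 1 / 80000 * (h ^ (-(1 / p)) * (h ^ 2)⁻¹)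
      ≤ (1 / 4 * ((1 / 4) * (h ^ (-(1 / p)) * h ^ 2))) * (1 / (5 * (5 * h) ^ 4)) := by
        have : h ^ (-(1 / p)) * (h ^ 2)⁻¹ = h ^ (-(1 / p)) * h ^ 2 * (1 / h ^ 4) := by
          field_simp
        have e : (1 / (5 * (5 * h) ^ 4)) = 1 / 3125 * (1 / h ^ 4) := by
          field_simp; norm_num
        rw [this, e]
        have : 0 < h ^ (-(1 / p)) * h ^ 2 * (1 / h ^ 4) := by positivity
        nlinarith
    _ ≤ _ := by
        gcongr

lemma proj_lower (p a : ℝ) (hp : 1 ≤ p) (ha : 3 / 4 < a) (ha1 : a < 1) :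
    (Real.pi)⁻¹ * (1 / 160000) * (1 - a) ^ (-(1 / p)) ≤ ‖bergmanProj (badF p) (a : ℂ)‖ := by
  have hi := GG_integrable p a hp (by linarith) ha1
  have hpos : 0 < 1 - a := by linarith
  unfold bergmanProj
  rw [proj_eq, norm_mul, norm_inv, Complex.norm_real, Real.norm_of_nonneg Real.pi_pos.le, mul_assoc]
  gcongr
  refine le_trans ?_ (Complex.re_le_norm _)
  have hre : (∫ q, GG p a q).re = ∫ q, (GG p a q).re := (integral_re hi).symm
  rw [hre]
  have hir : Integrable (fun q => (GG p a q).re) := hi.re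
  set S := Set.Ioo (1 - 3 * (1 - a)) (1 - 2 * (1 - a)) ×ˢ Set.Ioo ((1 - a) / 2) (1 - a) with hS
  have hv : volume S = ENNReal.ofReal (1 - a) * ENNReal.ofReal ((1 - a) / 2) := by
    rw [hS, Measure.volume_eq_prod, Measure.prod_prod, Real.volume_Ioo, Real.volume_Ioo]
    congr 2 <;> ring
  have hvr : (volume : Measure (ℝ × ℝ)).real S = (1 - a) * ((1 - a) / 2) := by
    rw [Measure.real, hv, ENNReal.toReal_mul, ENNReal.toReal_ofReal hpos.le,
      ENNReal.toReal_ofReal (by positivity)]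
  have h1 := setIntegral_ge_of_const_le_real (μ := (volume : Measure (ℝ × ℝ))) (s := S)
    (f := fun q => (GG p a q).re) (c := 1 / 80000 * ((1 - a) ^ (-(1 / p)) * ((1 - a) ^ 2)⁻¹))
    (measurableSet_Ioo.prod measurableSet_Ioo)
    (by rw [hv]; exact ENNReal.mul_ne_top ENNReal.ofReal_ne_top ENNReal.ofReal_ne_top)
    (fun q hq => GG_re_lower p a q.1 q.2 hp ha ha1 hq.1 hq.2) hir.integrableOn
  have h2 := setIntegral_le_integral (s := S) hir
    (Filter.Eventually.of_forall (GG_re_nonneg p a (by linarith) ha1))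
  refine le_trans (le_of_eq ?_) (h1.trans h2)
  rw [hvr]
  field_simp
  norm_num

lemma part1 (p : ℝ) (hp : 1 ≤ p) (θ : ℝ) :
    (∫⁻ r in Set.Ioo (0:ℝ) 1,
            ENNReal.ofReal
              (‖badF p ((r : ℂ) * Complex.exp ((θ : ℂ) * Complex.I))‖ ^ p))
          ≤ ENNReal.ofReal 1 := by
  set t := (Complex.exp ((θ : ℂ) * Complex.I)).arg with ht
  have hex : Complex.exp ((θ : ℂ) * Complex.I) = Complex.exp ((t : ℂ) * Complex.I) := by
    have := Complex.norm_mul_exp_arg_mul_I (Complex.exp ((θ : ℂ) * Complex.I))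
    rw [Complex.norm_exp_ofReal_mul_I] at this
    simpa using this.symm
  have htm : t ∈ Set.Ioc (-Real.pi) Real.pi := Complex.arg_mem_Ioc _
  clear_value t
  rw [hex]
  by_cases hc : 0 < t ∧ t < 1 / 2
  swap
  · rw [setLIntegral_congr_fun (g := fun _ => 0) measurableSet_Ioo]
    · simp
    · intro r hr
      dsimp only
      rw [badF_polar p r t hr.1 htm, if_neg (fun h => hc ⟨h.1, h.2.1⟩), norm_zero,
        Real.zero_rpow (by linarith), ENNReal.ofReal_zero]
  obtain ⟨h1, h2⟩ := hc
  have hsub : Set.uIcc 0 (1 - 2 * t) = Set.Icc 0 (1 - 2 * t) := Set.uIcc_of_le (by linarith)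
  have hcont : IntervalIntegrable (fun r : ℝ => t ^ (2 * p - 1) * (1 - r) ^ (-(2 * p))) volume 0 (1 - 2 * t) := by
    apply ContinuousOn.intervalIntegrable
    apply ContinuousOn.mul continuousOn_const
    apply ContinuousOn.rpow_const (by fun_prop)
    intro x hx
    rw [hsub] at hx
    left
    have := hx.2
    linarith
  rw [intervalIntegrable_iff_integrableOn_Ioo_of_le (by linarith)] at hcont
  have hval : ∫ r in Set.Ioo 0 (1 - 2 * t), t ^ (2 * p - 1) * (1 - r) ^ (-(2 * p)) ≤ 1 := by
    rw [← integral_Ioc_eq_integral_Ioo, ← intervalIntegral.integral_of_le (by linarith),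
      intervalIntegral.integral_const_mul,
      intervalIntegral.integral_comp_sub_left (fun x : ℝ => x ^ (-(2 * p))) 1, integral_rpow]
    · have e : 1 - (1 - 2 * t) = 2 * t := by ring
      rw [e, sub_zero, Real.one_rpow]
      have e1 : (2 * t) ^ (-(2 * p) + 1) ≤ t ^ (-(2 * p) + 1) :=
        Real.rpow_le_rpow_of_nonpos h1 (by linarith) (by linarith)
      have e2 : (1 - (2 * t) ^ (-(2 * p) + 1)) / (-(2 * p) + 1) =
          ((2 * t) ^ (-(2 * p) + 1) - 1) / (2 * p - 1) := by
        rw [← neg_div_neg_eq]; congr 1 <;> ring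
      have e3 : ((2 * t) ^ (-(2 * p) + 1) - 1) / (2 * p - 1) ≤ t ^ (-(2 * p) + 1) := by
        rw [div_le_iff₀ (by linarith)]
        have : 0 < t ^ (-(2 * p) + 1) := by positivity
        nlinarith
      rw [e2]
      calc _ ≤ t ^ (2 * p - 1) * t ^ (-(2 * p) + 1) := by gcongr
        _ = 1 := by rw [← Real.rpow_add h1]; ring_nf; simp
    · right
      refine ⟨by linarith, ?_⟩
      rw [Set.uIcc_of_le (by linarith)]
      rintro ⟨h, _⟩
      linarith
  refine le_trans ?_ (ENNReal.ofReal_le_ofReal hval)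
  rw [ofReal_integral_eq_lintegral_ofReal hcont]
  · rw [← lintegral_indicator measurableSet_Ioo, ← lintegral_indicator measurableSet_Ioo]
    apply lintegral_mono
    intro r
    by_cases hr : r ∈ Set.Ioo (0:ℝ) 1
    swap
    · rw [Set.indicator_of_notMem hr]; exact zero_le
    rw [Set.indicator_of_mem hr, badF_polar p r t hr.1 htm]
    by_cases hr2 : r < 1 - 2 * t
    swap
    · rw [if_neg (fun h => hr2 h.2.2), norm_zero, Real.zero_rpow (by linarith), ENNReal.ofReal_zero]
      exact zero_le
    rw [if_pos ⟨h1, h2, hr2⟩, Set.indicator_of_mem (show r ∈ Set.Ioo 0 (1 - 2 * t) from ⟨hr.1, hr2⟩)]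
    apply ENNReal.ofReal_le_ofReal
    have hr0 := hr.1
    have hr1 : 0 < 1 - r := by linarith [hr.2]
    have hA : 1 - r ≤ ‖KK t ((1 - t) * r)‖ :=
      le_trans (by nlinarith) (KK_norm_ge (by apply mul_nonneg <;> linarith))
    rw [norm_div, norm_pow, Complex.norm_real, Real.norm_of_nonneg (by positivity)]
    calc (t ^ (2 - 1 / p) / ‖KK t ((1 - t) * r)‖ ^ 2) ^ p
        ≤ (t ^ (2 - 1 / p) / (1 - r) ^ 2) ^ p := by gcongr
      _ = t ^ (2 * p - 1) * (1 - r) ^ (-(2 * p)) := by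
        rw [Real.div_rpow (by positivity) (by positivity), ← Real.rpow_mul h1.le, div_eq_mul_inv,
          ← Real.rpow_natCast, ← Real.rpow_mul hr1.le, ← Real.rpow_neg hr1.le]
        congr 2
        field_simp
  · rw [Filter.EventuallyLE, ae_restrict_iff' measurableSet_Ioo]
    refine Filter.Eventually.of_forall (fun r hr => ?_)
    have hr1 : 0 < 1 - r := by linarith [hr.2]
    simp only [Pi.zero_apply]
    positivity

lemma part3 (p c : ℝ) (hp : 1 ≤ p) (hc : 0 < c) (F : ℝ → ℝ)
    (h : ∀ a : ℝ, a ∈ Set.Ioo (3/4 : ℝ) 1 → c * (1 - a) ^ (-(1 / p)) ≤ F a) (C : ℝ)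
    (hC : (∫⁻ r in Set.Ioo (0:ℝ) 1, ENNReal.ofReal (F r ^ p)) ≤ ENNReal.ofReal C) : False := by
  have h1 : (∫⁻ r in Set.Ioo (3/4:ℝ) 1, ENNReal.ofReal (c ^ p * (1 - r)⁻¹)) ≤ ENNReal.ofReal C := by
    refine le_trans ?_ hC
    refine le_trans ?_ (lintegral_mono_set (Set.Ioo_subset_Ioo_left (by norm_num : (0:ℝ) ≤ 3/4)))
    apply setLIntegral_mono' measurableSet_Ioo
    intro r hr
    apply ENNReal.ofReal_le_ofReal
    have hr1 : 0 < 1 - r := by linarith [hr.2]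
    calc c ^ p * (1 - r)⁻¹ = (c * (1 - r) ^ (-(1 / p))) ^ p := by
          rw [Real.mul_rpow hc.le (by positivity), ← Real.rpow_mul hr1.le, ← Real.rpow_neg_one]
          congr 2
          field_simp
      _ ≤ _ := by
          have := h r hr
          gcongr
  have h2 := (lintegral_ofReal_ne_top_iff_integrable (by fun_prop) (by
    rw [Filter.EventuallyLE, ae_restrict_iff' measurableSet_Ioo]
    refine Filter.Eventually.of_forall (fun r hr => ?_)
    have hr1 : 0 < 1 - r := by linarith [hr.2]
    simp only [Pi.zero_apply]
    positivity)).1 (ne_top_of_le_ne_top ENNReal.ofReal_ne_top h1)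
  have h3 : IntegrableOn (fun r : ℝ => (r - 1)⁻¹) (Set.Ioo (3/4:ℝ) 1) := by
    have hcp : c ^ p ≠ 0 := by positivity
    have := h2.const_mul (-(c ^ p)⁻¹)
    refine this.congr (Filter.Eventually.of_forall fun r => ?_)
    dsimp only
    rw [← neg_sub, inv_neg]
    field_simp
  rw [← intervalIntegrable_iff_integrableOn_Ioo_of_le (by norm_num), intervalIntegrable_sub_inv_iff] at h3
  rcases h3 with h3 | h3
  · norm_num at h3
  · exact h3 Set.right_mem_uIcc

/-- For `1 ≤ p < ∞`, the function `badF p` lies in `L^∞(𝕋, L^p[0,1])`, but its Bergman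
projection satisfies `|P(f)(a)| ≳ (1-a)^{-1/p}` on `(3/4,1)`; hence `P(f) ∉ RM(p,∞)`. -/
theorem stmt_19 (p : ℝ) (hp : 1 ≤ p) :
    (∃ C : ℝ, ∀ θ : ℝ,
        (∫⁻ r in Set.Ioo (0:ℝ) 1,
            ENNReal.ofReal
              (‖badF p ((r : ℂ) * Complex.exp ((θ : ℂ) * Complex.I))‖ ^ p))
          ≤ ENNReal.ofReal C) ∧
    (∃ c : ℝ, 0 < c ∧ ∀ a : ℝ, a ∈ Set.Ioo (3/4 : ℝ) 1 →
        c * (1 - a) ^ (-(1 / p)) ≤ ‖bergmanProj (badF p) (a : ℂ)‖) ∧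
    ¬ ∃ C : ℝ, ∀ θ : ℝ,
        (∫⁻ r in Set.Ioo (0:ℝ) 1,
            ENNReal.ofReal
              (‖bergmanProj (badF p) ((r : ℂ) * Complex.exp ((θ : ℂ) * Complex.I))‖ ^ p))
          ≤ ENNReal.ofReal C := by

  have hlow : ∀ a : ℝ, a ∈ Set.Ioo (3/4 : ℝ) 1 →
      (Real.pi)⁻¹ * (1 / 160000) * (1 - a) ^ (-(1 / p)) ≤ ‖bergmanProj (badF p) (a : ℂ)‖ :=
    fun a ha => proj_lower p a hp ha.1 ha.2
  have hc : 0 < (Real.pi)⁻¹ * (1 / 160000 : ℝ) := by have := Real.pi_pos; positivity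
  refine ⟨⟨1, part1 p hp⟩, ⟨_, hc, hlow⟩, ?_⟩
  rintro ⟨C, hC⟩
  refine part3 p _ hp hc (fun a => ‖bergmanProj (badF p) (a : ℂ)‖) hlow C ?_
  have := hC 0
  simpa using this
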